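/- arXiv:1904.08255 — 2 statements merged into one kernel-verified Lean document; each statement's English description precedes it below -/
import Mathlib

section
/- For every κ ≥ 1 and all real numbers y₀, y_c with 0 ≤ y₀ ≤ y_c ≤ 1, one has f_κ(1−y₀) + ∫_{y₀}^{y_c} (1−x)/f_κ(x) dx = f_κ(1−y_c). -/
/-- The Wang–Wong function `f_κ`. -/
noncomputable def fWW (κ θ : ℝ) : ℝ :=
  ((1 + κ) / 2 - θ) ^ ((1 + κ) / (2 * κ)) * (θ + (κ - 1) / 2) ^ ((κ - 1) / (2 * κ))

theorem continuous_fWW {κ : ℝ} (hκ : 1 ≤ κ) : Continuous (fWW κ) := by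
  have hp : 0 ≤ (1 + κ) / (2 * κ) := by positivity
  have hq : 0 ≤ (κ - 1) / (2 * κ) := div_nonneg (by linarith) (by linarith)
  exact ((continuous_const.sub continuous_id).rpow_const fun _ => Or.inr hp).mul
    ((continuous_id.add continuous_const).rpow_const fun _ => Or.inr hq)

theorem fWW_pos {κ x : ℝ} (hκ : 1 ≤ κ) (hx0 : 0 < x) (hx1 : x < 1) : 0 < fWW κ x :=
  mul_pos (Real.rpow_pos_of_pos (by linarith) _) (Real.rpow_pos_of_pos (by linarith) _)

theorem hasDerivAt_fWW_one_sub {κ x : ℝ} (hκ : 1 ≤ κ) (hx0 : 0 < x) (hx1 : x < 1) :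
    HasDerivAt (fun y => fWW κ (1 - y)) ((1 - x) / fWW κ x) x := by
  have hA : 0 < x + (κ - 1) / 2 := by linarith
  have hB : 0 < (1 + κ) / 2 - x := by linarith
  have hκ0 : κ ≠ 0 := by linarith
  have hA' : (1 + κ) / 2 - (1 - x) = x + (κ - 1) / 2 := by ring
  have hB' : 1 - x + (κ - 1) / 2 = (1 + κ) / 2 - x := by ring
  have hsub : HasDerivAt (fun y : ℝ => 1 - y) (-1) x := (hasDerivAt_id x).const_sub 1
  have h1 := (hsub.const_sub ((1 + κ) / 2)).rpow_const (p := (1 + κ) / (2 * κ))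
    (Or.inl (by rw [hA']; exact hA.ne'))
  have h2 := (hsub.add_const ((κ - 1) / 2)).rpow_const (p := (κ - 1) / (2 * κ))
    (Or.inl (by rw [hB']; exact hB.ne'))
  refine (h1.mul h2).congr_deriv ?_
  have hp : (1 + κ) / (2 * κ) = 1 - (κ - 1) / (2 * κ) := by field_simp; ring
  have hcoef : (1 - (κ - 1) / (2 * κ)) * ((1 + κ) / 2 - x)
      - (κ - 1) / (2 * κ) * (x + (κ - 1) / 2) = 1 - x := by field_simp; ring
  simp only [fWW, hA', hB', hp]
  rw [← hcoef]
  generalize (κ - 1) / (2 * κ) = q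
  generalize x + (κ - 1) / 2 = A at *
  generalize (1 + κ) / 2 - x = B at *
  have hAq := Real.rpow_pos_of_pos hA q
  have hBq := Real.rpow_pos_of_pos hB q
  rw [show 1 - q - 1 = -q by ring, Real.rpow_neg hA.le, Real.rpow_sub hA, Real.rpow_sub hB,
    Real.rpow_sub hB, Real.rpow_one, Real.rpow_one]
  field_simp
  ring

/-- Appendix B computation: `f_κ(1−y₀) + ∫_{y₀}^{y_c} (1−x)/f_κ(x) dx = f_κ(1−y_c)`. -/
theorem fWW_integral_identity (κ : ℝ) (hκ : 1 ≤ κ) (y₀ yc : ℝ)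
    (h0 : 0 ≤ y₀) (h01 : y₀ ≤ yc) (hc : yc ≤ 1) :
    fWW κ (1 - y₀) + ∫ x in y₀..yc, (1 - x) / fWW κ x = fWW κ (1 - yc) := by
  have hcont : Continuous fun x => fWW κ (1 - x) :=
    (continuous_fWW hκ).comp (continuous_const.sub continuous_id)
  have hderiv : ∀ x ∈ Set.Ioo y₀ yc,
      HasDerivAt (fun y => fWW κ (1 - y)) ((1 - x) / fWW κ x) x := fun x hx =>
    hasDerivAt_fWW_one_sub hκ (h0.trans_lt hx.1) (hx.2.trans_le hc)
  have hnonneg : ∀ x ∈ Set.Ioo y₀ yc, 0 ≤ (1 - x) / fWW κ x := fun x hx =>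
    div_nonneg (by linarith [hx.2]) (fWW_pos hκ (h0.trans_lt hx.1) (hx.2.trans_le hc)).le
  have hint : IntervalIntegrable (fun x => (1 - x) / fWW κ x) MeasureTheory.volume y₀ yc :=
    intervalIntegral.intervalIntegrable_deriv_of_nonneg hcont.continuousOn
      (by simpa only [min_eq_left h01, max_eq_right h01] using hderiv)
      (by simpa only [min_eq_left h01, max_eq_right h01] using hnonneg)
  rw [intervalIntegral.integral_eq_sub_of_hasDerivAt_of_le h01 hcont.continuousOn hderiv hint]
  ring
end

section
/- There exist constants c ∈ (0,1) and ε₀ ∈ (0,1) such that for every ε ∈ (0, ε₀) and every θ ∈ [0,1] with θ ≤ c or θ ≥ 1−c, one has (2−ε) − θ − f_{1+2ε}(1−θ) > 0 and f_{1+2ε}(θ) + 1 − θ ≤ (2−ε) − θ − f_{1+2ε}(1−θ). -/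
/-- The Wang–Wong function in terms of the distance of `log` of the two factors. -/
theorem fWW_eq_mul_exp {κ θ : ℝ} (hκ : 0 < κ) (hx : 0 < (1 + κ) / 2 - θ)
    (hy : 0 < θ + (κ - 1) / 2) :
    fWW κ θ = ((1 + κ) / 2 - θ) * Real.exp (-((κ - 1) / (2 * κ) *
      (Real.log ((1 + κ) / 2 - θ) - Real.log (θ + (κ - 1) / 2)))) := by
  have ha : (1 + κ) / (2 * κ) = 1 - (κ - 1) / (2 * κ) := by field_simp; ring
  rw [fWW, Real.rpow_def_of_pos hx, Real.rpow_def_of_pos hy, ha, ← Real.exp_add]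
  nth_rewrite 2 [← Real.exp_log hx]
  rw [← Real.exp_add]
  congr 1
  ring

theorem fWW_pos_s14 {κ θ : ℝ} (hx : 0 < (1 + κ) / 2 - θ) (hy : 0 < θ + (κ - 1) / 2) :
    0 < fWW κ θ :=
  mul_pos (Real.rpow_pos_of_pos hx _) (Real.rpow_pos_of_pos hy _)

theorem fWW_add_fWW_one_sub_le {ε θ : ℝ} (hε : 0 < ε) (hε' : ε < 1 / 2000) (hθ : 0 ≤ θ)
    (hθ' : θ ≤ 1 / 2000) :
    fWW (1 + 2 * ε) θ + fWW (1 + 2 * ε) (1 - θ) ≤ 1 - ε := by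
  have hx : 0 < 1 + ε - θ := by linarith
  have hy : 0 < θ + ε := by linarith
  have e₁ : (1 + (1 + 2 * ε)) / 2 - θ = 1 + ε - θ := by ring
  have e₂ : θ + (1 + 2 * ε - 1) / 2 = θ + ε := by ring
  have e₃ : (1 + (1 + 2 * ε)) / 2 - (1 - θ) = θ + ε := by ring
  have e₄ : 1 - θ + (1 + 2 * ε - 1) / 2 = 1 + ε - θ := by ring
  have e₅ : (1 + 2 * ε - 1) / (2 * (1 + 2 * ε)) = ε / (1 + 2 * ε) := by field_simp; ring
  rw [fWW_eq_mul_exp (by linarith) (by linarith) (by linarith),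
    fWW_eq_mul_exp (by linarith) (by linarith) (by linarith), e₁, e₂, e₃, e₄, e₅,
    ← neg_sub (Real.log (1 + ε - θ)), mul_neg, neg_neg, ← Real.log_div hx.ne' hy.ne']
  set L := Real.log ((1 + ε - θ) / (θ + ε)) with hL
  have hL6 : 6 ≤ L := by
    rw [hL, Real.le_log_iff_exp_le (by positivity), le_div_iff₀ hy]
    have h6 : Real.exp 6 ≤ 900 := by
      have h : Real.exp 6 = Real.exp 1 ^ 6 := by rw [← Real.exp_nat_mul]; norm_num
      rw [h]
      calc Real.exp 1 ^ 6 ≤ 2.75 ^ 6 := by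
            gcongr
            linarith [Real.exp_one_lt_d9]
        _ ≤ 900 := by norm_num
    nlinarith
  have hLsq : ε * L ^ 2 ≤ 3 := by
    have h := Real.quadratic_le_exp_of_nonneg (show 0 ≤ L by linarith)
    rw [hL, Real.exp_log (by positivity), ← hL, le_div_iff₀ hy] at h
    nlinarith [mul_nonneg hθ (sq_nonneg L), mul_pos hε (show 0 < 1 + L by linarith),
      mul_nonneg hθ (show 0 ≤ 1 + L by linarith)]
  set u := ε / (1 + 2 * ε) * L with hu
  have hu_mul : u * (1 + 2 * ε) = ε * L := by rw [hu]; field_simp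
  have hu0 : 0 ≤ u := by positivity
  have huL : u ≤ ε * L := by nlinarith
  have hu4 : u ≤ 1 / 4 := by
    have : ε * L ≤ 1 / 4 := by
      refine abs_le_of_sq_le_sq' ?_ (by norm_num) |>.2
      nlinarith
    linarith
  have exp_le {v : ℝ} (hv : |v| ≤ 1) : Real.exp v ≤ 1 + v + v ^ 2 := by
    linarith [(abs_le.1 (Real.abs_exp_sub_one_sub_id_le hv)).2]
  have h₁ := exp_le (v := -u) (by rw [abs_neg, abs_of_nonneg hu0]; linarith)
  have h₂ := exp_le (v := u) (by rw [abs_of_nonneg hu0]; linarith)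
  have key : 3 * ε + (1 + 2 * ε) * u ^ 2 ≤ u * (1 - 2 * θ) := by
    have hsub : 3 * ε ≤ u * (3 / 4 - 1 / 4) * (1 + 2 * ε) := by nlinarith
    have hfac : (3 / 4 - 1 / 4) * (1 + 2 * ε) ≤ 1 - 2 * θ - (1 + 2 * ε) * u := by nlinarith
    nlinarith [mul_le_mul_of_nonneg_left hfac hu0]
  nlinarith [mul_le_mul_of_nonneg_left h₁ hx.le, mul_le_mul_of_nonneg_left h₂ hy.le]

/-- Analytic core of Lemma 3.6(1): near the endpoints the ratio is at most 1. -/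
theorem fWW_ratio_le_one :
    ∃ c ∈ Set.Ioo (0 : ℝ) 1, ∃ ε₀ ∈ Set.Ioo (0 : ℝ) 1,
      ∀ ε ∈ Set.Ioo (0 : ℝ) ε₀, ∀ θ ∈ Set.Icc (0 : ℝ) 1, (θ ≤ c ∨ 1 - c ≤ θ) →
        0 < (2 - ε) - θ - fWW (1 + 2 * ε) (1 - θ) ∧
        fWW (1 + 2 * ε) θ + 1 - θ ≤ (2 - ε) - θ - fWW (1 + 2 * ε) (1 - θ) := by
  refine ⟨1 / 2000, by norm_num, 1 / 2000, by norm_num, ?_⟩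
  rintro ε ⟨hε, hε'⟩ θ ⟨hθ, hθ'⟩ h
  have hsum : fWW (1 + 2 * ε) θ + fWW (1 + 2 * ε) (1 - θ) ≤ 1 - ε := by
    rcases h with h | h
    · exact fWW_add_fWW_one_sub_le hε hε' hθ h
    · have := fWW_add_fWW_one_sub_le (θ := 1 - θ) hε hε' (by linarith) (by linarith)
      rw [sub_sub_cancel] at this
      linarith
  have hpos : 0 < fWW (1 + 2 * ε) θ := fWW_pos_s14 (by linarith) (by linarith)
  constructor <;> linarith
end
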